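/- Let r ≥ 3 and let F be the graph obtained from K_r by adding one new vertex joined to exactly one vertex of the K_r. Then: (i) for every connected graph H with H ≠ K_r there exists N such that for all n ≥ N, ex(n, H, F) = ex(n, H, K_r); and (ii) for every n, ex(n, K_r, F) = ⌊n/r⌋. -/

import Mathlib

open SimpleGraph Finset Filter

/-- The number of copies of `H` in `G`, i.e. the number of subgraphs of `G`
whose underlying graph is isomorphic to `H`. -/
noncomputable def copyCount {α β : Type*} (H : SimpleGraph α) (G : SimpleGraph β) : ℕ :=
  Nat.card {G' : G.Subgraph // Nonempty (H ≃g G'.coe)}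

/-- `G` is `F`-free: `G` contains no subgraph isomorphic to `F`. -/
def GFree {α β : Type*} (F : SimpleGraph α) (G : SimpleGraph β) : Prop :=
  ¬ ∃ f : α ↪ β, ∀ a b, F.Adj a b → G.Adj (f a) (f b)

/-- The generalized Turán number `ex(n, H, F)`: the maximal number of copies of `H`
in an `F`-free graph on `n` vertices. -/
noncomputable def exN {α β : Type*} (n : ℕ) (H : SimpleGraph α) (F : SimpleGraph β) : ℕ :=
  sSup {m | ∃ G : SimpleGraph (Fin n), GFree F G ∧ copyCount H G = m}

/-- The star `S_r` on `r` vertices: vertex `0` is joined to all other vertices. -/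
def starGraph (r : ℕ) : SimpleGraph (Fin r) :=
  SimpleGraph.fromRel (fun i _ => i.val = 0)

/-- The matching `M_k` with `k` disjoint edges `{2i, 2i+1}`. -/
def matchingGraph (k : ℕ) : SimpleGraph (Fin (2 * k)) :=
  SimpleGraph.fromRel (fun i j => i.val / 2 = j.val / 2)

def friendshipGraph (n : ℕ) : SimpleGraph (Fin n) :=
  SimpleGraph.fromRel (fun i j => i.val = 0 ∨ (i.val + 1) / 2 = (j.val + 1) / 2)

def pawGraph : SimpleGraph (Fin 4) :=
  SimpleGraph.fromRel (fun i j => (i.val ≤ 2 ∧ j.val ≤ 2) ∨ i.val = 0)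

def triangleWithLeaves (l : ℕ) : SimpleGraph (Fin (l + 3)) :=
  SimpleGraph.fromRel (fun i j => (i.val ≤ 2 ∧ j.val ≤ 2) ∨ i.val = 0)

def bookGraph (k : ℕ) : SimpleGraph (Fin (k + 2)) :=
  SimpleGraph.fromRel (fun i _ => i.val ≤ 1)

def triangleFactor (n : ℕ) : SimpleGraph (Fin n) :=
  SimpleGraph.fromRel (fun i j => i.val / 3 = j.val / 3)

def splitGraph (n a : ℕ) : SimpleGraph (Fin n) :=
  SimpleGraph.fromRel (fun i j => i.val < a ∧ ¬ j.val < a)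

def cliquePlusPendant (r : ℕ) : SimpleGraph (Fin (r + 1)) :=
  SimpleGraph.fromRel (fun i j => (i.val < r ∧ j.val < r) ∨ i.val = 0)

theorem gfree_iff_isEmpty_copy {α β : Type*} {F : SimpleGraph α} {G : SimpleGraph β} :
    GFree F G ↔ IsEmpty (Copy F G) := by
  unfold GFree
  rw [← not_nonempty_iff, not_iff_not]
  constructor
  · rintro ⟨f, hf⟩
    exact ⟨⟨⟨f, fun {a b} h => hf a b h⟩, f.injective⟩⟩
  · rintro ⟨f⟩
    exact ⟨f.toEmbedding, fun a b h => f.toHom.map_adj h⟩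

theorem gfree_top_iff_cliqueFree {β : Type*} {r : ℕ} {G : SimpleGraph β} :
    GFree (⊤ : SimpleGraph (Fin r)) G ↔ G.CliqueFree r := by
  rw [gfree_iff_isEmpty_copy, cliqueFree_iff]

theorem card_copy_eq_copyCount_mul {α β : Type*} [Finite α] [Finite β]
    (H : SimpleGraph α) (G : SimpleGraph β) :
    Nat.card (Copy H G) = _root_.copyCount H G * Nat.card (H ≃g H) := by
  unfold _root_.copyCount
  rw [← Nat.card_prod]
  let e : ∀ G' : {G' : G.Subgraph // Nonempty (H ≃g G'.coe)}, H ≃g G'.1.coe :=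
    fun G' => G'.2.some
  let Φ : {G' : G.Subgraph // Nonempty (H ≃g G'.coe)} × (H ≃g H) → Copy H G :=
    fun p => p.1.1.coeCopy.comp ((e p.1).toCopy.comp p.2.toCopy)
  have hΦ : ∀ p a, Φ p a = (e p.1 (p.2 a) : β) := fun p a => rfl
  have hsub : ∀ p, (Φ p).toSubgraph = p.1.1 := by
    rintro ⟨⟨G', hG'⟩, σ⟩
    have : (Φ (⟨G', hG'⟩, σ)).toHom
        = G'.hom.comp ((e ⟨G', hG'⟩).comp σ).toHom := rfl
    rw [Copy.toSubgraph, this, Subgraph.map_comp]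
    simp
  refine (Nat.card_eq_of_bijective Φ ⟨?_, ?_⟩).symm
  · rintro ⟨G₁, σ₁⟩ ⟨G₂, σ₂⟩ h
    obtain rfl : G₁ = G₂ := Subtype.ext (by rw [← hsub (G₁, σ₁), h, hsub])
    refine Prod.ext rfl (RelIso.ext fun a => ?_)
    have := DFunLike.congr_fun h a
    rw [hΦ, hΦ] at this
    exact (e G₁).injective (Subtype.ext this)
  · intro f
    let G' : {G' : G.Subgraph // Nonempty (H ≃g G'.coe)} := ⟨f.toSubgraph, ⟨f.isoToSubgraph⟩⟩
    refine ⟨(G', f.isoToSubgraph.trans (e G').symm), Copy.ext fun a => ?_⟩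
    rw [hΦ]
    have : e G' ((e G').symm (f.isoToSubgraph a)) = f.isoToSubgraph a :=
      (e G').apply_symm_apply _
    change ((e G' ((e G').symm (f.isoToSubgraph a)) : G'.1.verts) : β) = f a
    rw [this]
    rfl

theorem copyCount_le_of_card_copy_le {α β β' : Type*} [Finite α] [Finite β] [Finite β']
    {H : SimpleGraph α} {G : SimpleGraph β} {G' : SimpleGraph β'}
    (h : Nat.card (Copy H G) ≤ Nat.card (Copy H G')) :
    _root_.copyCount H G ≤ _root_.copyCount H G' := by
  rw [card_copy_eq_copyCount_mul, card_copy_eq_copyCount_mul] at h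
  have : Finite (H ≃g H) := Finite.of_injective (fun σ => (σ : α → α)) DFunLike.coe_injective
  have : Nonempty (H ≃g H) := ⟨Iso.refl⟩
  exact Nat.le_of_mul_le_mul_right h Nat.card_pos

theorem bddAbove_copyCount_gfree {α β : Type*} (n : ℕ) (H : SimpleGraph α) (F : SimpleGraph β) :
    BddAbove {m | ∃ G : SimpleGraph (Fin n), GFree F G ∧ _root_.copyCount H G = m} := by
  refine ((Set.finite_range fun G : SimpleGraph (Fin n) => _root_.copyCount H G).subset ?_).bddAbove
  rintro m ⟨G, -, rfl⟩
  exact ⟨G, rfl⟩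

theorem copyCount_le_exN {α β : Type*} {n : ℕ} {H : SimpleGraph α} {F : SimpleGraph β}
    {G : SimpleGraph (Fin n)} (hG : GFree F G) : _root_.copyCount H G ≤ exN n H F :=
  le_csSup (bddAbove_copyCount_gfree n H F) ⟨G, hG, rfl⟩

theorem exN_le {α β : Type*} {n m : ℕ} {H : SimpleGraph α} {F : SimpleGraph β}
    (h : ∀ G : SimpleGraph (Fin n), GFree F G → _root_.copyCount H G ≤ m) : exN n H F ≤ m := by
  refine csSup_le' ?_
  rintro _ ⟨G, hG, rfl⟩
  exact h G hG

theorem card_copy_eq_sum_rooted {α β : Type*} [Finite α] [Fintype β] (H : SimpleGraph α)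
    (G : SimpleGraph β) (v : α) :
    Nat.card (Copy H G) = ∑ x, Nat.card {f : Copy H G // f v = x} := by
  have : Finite (Copy H G) := Finite.of_injective (fun f => (f : α → β)) DFunLike.coe_injective
  rw [← Nat.card_congr (Equiv.sigmaFiberEquiv fun f : Copy H G => f v), Nat.card_sigma]

theorem SimpleGraph.Copy.apply_mem_of_connected {α β : Type*} {H : SimpleGraph α} {G : SimpleGraph β}
    (hH : H.Connected) {S : Set β} (hS : ∀ x ∈ S, ∀ y, G.Adj x y → y ∈ S)
    (f : Copy H G) {v : α} (hv : f v ∈ S) (w : α) : f w ∈ S := by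
  obtain ⟨p⟩ := hH.preconnected v w
  induction p with
  | nil => exact hv
  | cons h _ ih => exact ih (hS _ hv _ (f.toHom.map_adj h))

/-- In a `(K_r + pendant edge)`-free graph, no edge leaves an `r`-clique. -/
theorem SimpleGraph.IsNClique.mem_of_adj_of_gfree {β : Type*} {r : ℕ} {G : SimpleGraph β}
    (hG : GFree (cliquePlusPendant r) G) {s : Finset β} (hs : G.IsNClique r s) {x y : β}
    (hx : x ∈ s) (hxy : G.Adj x y) : y ∈ s := by
  classical
  by_contra hy
  have hr : 0 < r := hs.card_eq ▸ Finset.card_pos.2 ⟨x, hx⟩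
  let e₀ : Fin r ≃ s := (Fintype.equivFinOfCardEq (by simp [hs.card_eq])).symm
  let e : Fin r ≃ s := (Equiv.swap ⟨0, hr⟩ (e₀.symm ⟨x, hx⟩)).trans e₀
  have he : e ⟨0, hr⟩ = ⟨x, hx⟩ := by simp [e]
  let g : Fin (r + 1) → β := fun i => if h : i.val < r then (e ⟨i, h⟩ : β) else y
  have hg : ∀ (i : Fin (r + 1)) (h : i.val < r), g i = e ⟨i, h⟩ := fun i h => dif_pos h
  have hg' : ∀ (i : Fin (r + 1)), ¬ i.val < r → g i = y := fun i h => dif_neg h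
  have hinj : Function.Injective g := by
    intro i j hij
    by_cases hi : i.val < r <;> by_cases hj : j.val < r
    · rw [hg i hi, hg j hj] at hij
      have := e.injective (Subtype.ext hij)
      exact Fin.ext (by simpa using this)
    · rw [hg i hi, hg' j hj] at hij
      exact absurd (hij ▸ (e ⟨i, hi⟩).2) hy
    · rw [hg' i hi, hg j hj] at hij
      exact absurd (hij ▸ (e ⟨j, hj⟩).2) hy
    · exact Fin.ext (by omega)
  have key : ∀ i j : Fin (r + 1), i ≠ j → ((i.val < r ∧ j.val < r) ∨ i.val = 0) →
      G.Adj (g i) (g j) := by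
    intro i j hij h
    by_cases hj : j.val < r
    · have hi : i.val < r := by omega
      have hne : g i ≠ g j := fun h => hij (hinj h)
      rw [hg i hi, hg j hj] at hne ⊢
      exact hs.isClique (e _).2 (e _).2 hne
    · have hi : i.val = 0 := by omega
      have : (⟨i.val, by omega⟩ : Fin r) = ⟨0, hr⟩ := Fin.ext hi
      rw [hg i (by omega), hg' j hj, this, he]
      exact hxy
  refine hG ⟨⟨g, hinj⟩, fun i j h => ?_⟩
  rw [cliquePlusPendant, fromRel_adj] at h
  rcases h with ⟨hne, h | h⟩
  · exact key i j hne h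
  · exact (key j i hne.symm h).symm

theorem SimpleGraph.CliqueFree.gfree_cliquePlusPendant {β : Type*} {r : ℕ} {G : SimpleGraph β}
    (hG : G.CliqueFree r) : GFree (cliquePlusPendant r) G := by
  rw [← gfree_top_iff_cliqueFree] at hG
  rintro ⟨f, hf⟩
  refine hG ⟨Fin.castSuccEmb.trans f, fun a b hab => hf _ _ ?_⟩
  rw [cliquePlusPendant, fromRel_adj]
  exact ⟨fun h => hab.ne (Fin.castSucc_injective r h), Or.inl (Or.inl ⟨a.2, b.2⟩)⟩

theorem card_rooted_copy_le_of_isNClique {α β : Type*} [Finite α] {r : ℕ} {H : SimpleGraph α}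
    {G : SimpleGraph β} (hH : H.Connected) (hG : GFree (cliquePlusPendant r) G)
    {s : Finset β} (hs : G.IsNClique r s) {x : β} (hx : x ∈ s) (v : α) (i : Fin r) :
    Nat.card {f : Copy H G // f v = x} ≤ Nat.card {f : α ↪ Fin r // f v = i} := by
  classical
  let e₀ : s ≃ Fin r := Fintype.equivFinOfCardEq (by simp [hs.card_eq])
  let e : s ≃ Fin r := e₀.trans (Equiv.swap (e₀ ⟨x, hx⟩) i)
  have he : e ⟨x, hx⟩ = i := by simp [e]
  have hmem : ∀ (f : {f : Copy H G // f v = x}) (w : α), f.1 w ∈ s := fun f w =>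
    Copy.apply_mem_of_connected hH (S := s)
      (fun _ ha _ hab => IsNClique.mem_of_adj_of_gfree hG hs ha hab) f.1 (v := v)
      (by rw [f.2]; exact hx) w
  refine Nat.card_le_card_of_injective
    (fun f => ⟨⟨fun w => e ⟨f.1 w, hmem f w⟩, fun a b hab => f.1.injective ?_⟩, ?_⟩) ?_
  · simpa using hab
  · have : (⟨f.1 v, hmem f v⟩ : s) = ⟨x, hx⟩ := Subtype.ext f.2
    change e ⟨f.1 v, hmem f v⟩ = i
    rw [this, he]
  · intro f g hfg
    refine Subtype.ext (Copy.ext fun w => ?_)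
    have : e ⟨f.1 w, hmem f w⟩ = e ⟨g.1 w, hmem g w⟩ :=
      DFunLike.congr_fun (congrArg Subtype.val hfg) w
    exact congrArg Subtype.val (e.injective this)

/-- Collapsing the complement of a union of components `B` onto `b ∈ B` and pulling back
the graph turns every vertex outside `B` into a twin of `b`. -/
theorem card_rooted_copy_le_comap {α β : Type*} [Finite α] [Finite β] {H : SimpleGraph α}
    {G : SimpleGraph β} (hH : H.Connected) {B : Set β}
    (hB : ∀ x ∈ B, ∀ y, G.Adj x y → y ∈ B) {φ : β → β} (hφ : ∀ x, φ x ∈ B)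
    (hφB : ∀ x ∈ B, φ x = x) (v : α) (x : β) :
    Nat.card {f : Copy H G // f v = φ x} ≤ Nat.card {f : Copy H (G.comap φ) // f v = x} := by
  classical
  have hmem : ∀ (f : {f : Copy H G // f v = φ x}) (w : α), f.1 w ∈ B := fun f w =>
    Copy.apply_mem_of_connected hH hB f.1 (v := v) (by rw [f.2]; exact hφ x) w
  have hcomp : ∀ (f : {f : Copy H G // f v = φ x}) (w : α),
      φ (Function.update (f.1 : α → β) v x w) = f.1 w := by
    intro f w
    by_cases hw : w = v
    · subst hw
      simp [f.2]
    · rw [Function.update_of_ne hw, hφB _ (hmem f w)]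
  have : Finite (Copy H (G.comap φ)) :=
    Finite.of_injective (fun f => (f : α → β)) DFunLike.coe_injective
  refine Nat.card_le_card_of_injective
    (fun f => ⟨⟨⟨Function.update (f.1 : α → β) v x, fun {a b} hab => ?_⟩,
      fun a b hab => f.1.injective ?_⟩, ?_⟩) ?_
  · rw [comap_adj, hcomp, hcomp]
    exact f.1.toHom.map_adj hab
  · have := congrArg φ hab
    change φ (Function.update (f.1 : α → β) v x a) = φ (Function.update (f.1 : α → β) v x b)
      at this
    rwa [hcomp, hcomp] at this
  · exact Function.update_self (β := fun _ => β) v x _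
  · intro f g hfg
    refine Subtype.ext (Copy.ext fun w => ?_)
    have : Function.update (f.1 : α → β) v x w = Function.update (g.1 : α → β) v x w :=
      DFunLike.congr_fun (congrArg Subtype.val hfg) w
    rw [← hcomp f, ← hcomp g, this]

/-- Either some `K_r`-free graph on the same vertex set has at least as many copies of `H`,
or `G` has at most as many copies as if every vertex lay in an `r`-clique. -/
theorem exists_cliqueFree_card_copy_ge_or_le {α β : Type*} [Finite α] [Fintype β] {r : ℕ}
    {H : SimpleGraph α} {G : SimpleGraph β} (hH : H.Connected)
    (hG : GFree (cliquePlusPendant r) G) (v : α) (i : Fin r) :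
    (∃ G' : SimpleGraph β, G'.CliqueFree r ∧ Nat.card (Copy H G) ≤ Nat.card (Copy H G')) ∨
      Nat.card (Copy H G) ≤ Fintype.card β * Nat.card {f : α ↪ Fin r // f v = i} := by
  classical
  by_cases h : ∀ x, Nat.card {f : Copy H G // f v = x} ≤ Nat.card {f : α ↪ Fin r // f v = i}
  · right
    rw [card_copy_eq_sum_rooted H G v]
    exact (Finset.sum_le_card_nsmul _ _ _ fun x _ => h x).trans (by simp)
  left
  push Not at h
  obtain ⟨b, hb⟩ := h
  let B : Set β := {x | ∀ s : Finset β, G.IsNClique r s → x ∉ s}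
  have hbig : ∀ x, x ∉ B → Nat.card {f : Copy H G // f v = x}
      ≤ Nat.card {f : α ↪ Fin r // f v = i} := by
    intro x hx
    obtain ⟨s, hs, hxs⟩ : ∃ s : Finset β, G.IsNClique r s ∧ x ∈ s := by
      simpa [B] using hx
    exact card_rooted_copy_le_of_isNClique hH hG hs hxs v i
  have hbB : b ∈ B := by
    by_contra hbB
    exact absurd (hbig b hbB) (not_le.2 hb)
  have hB : ∀ x ∈ B, ∀ y, G.Adj x y → y ∈ B := fun x hx y hxy s hs hys =>
    hx s hs (IsNClique.mem_of_adj_of_gfree hG hs hys hxy.symm)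
  let φ : β → β := fun x => if x ∈ B then x else b
  have hφ : ∀ x, φ x ∈ B := by
    intro x
    by_cases hx : x ∈ B
    · simp [φ, hx]
    · simpa [φ, hx] using hbB
  have hφB : ∀ x ∈ B, φ x = x := fun x hx => if_pos hx
  refine ⟨G.comap φ, ?_, ?_⟩
  · rw [cliqueFree_iff]
    refine ⟨fun f => ?_⟩
    let g : Copy (completeGraph (Fin r)) G :=
      ⟨⟨fun j => φ (f j), fun {j k} hjk => f.toHom.map_adj hjk⟩, Hom.injective_of_top_hom _⟩
    have hs : G.IsNClique r (Finset.univ.map g.toEmbedding) := by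
      rw [isNClique_iff]
      refine ⟨?_, by simp⟩
      intro x hx y hy hxy
      simp only [Finset.coe_map, Finset.coe_univ, Set.image_univ, Set.mem_range] at hx hy
      obtain ⟨j, rfl⟩ := hx
      obtain ⟨k, rfl⟩ := hy
      exact g.toHom.map_adj (fun h => hxy (by rw [h]))
    exact hφ (f i) _ hs (Finset.mem_map.2 ⟨i, Finset.mem_univ _, rfl⟩)
  · rw [card_copy_eq_sum_rooted H G v, card_copy_eq_sum_rooted H _ v]
    refine Finset.sum_le_sum fun x _ => le_trans ?_
      (card_rooted_copy_le_comap hH hB hφ hφB v x)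
    by_cases hx : x ∈ B
    · rw [hφB x hx]
    · have hφx : φ x = b := if_neg hx
      rw [hφx]
      exact (hbig x hx).trans hb.le

theorem descFactorial_le_card_copy_turanGraph {α : Type*} [Fintype α] {H : SimpleGraph α}
    {n k : ℕ} (hH : H.Colorable k) :
    (n / k).descFactorial (Fintype.card α) ≤ Nat.card (Copy H (turanGraph n k)) := by
  classical
  obtain ⟨c⟩ := hH
  have : Finite (Copy H (turanGraph n k)) :=
    Finite.of_injective (fun f => (f : α → Fin n)) DFunLike.coe_injective
  have hlt : ∀ (t : α ↪ Fin (n / k)) (a : α), (c a).val + k * (t a).val < n := by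
    intro t a
    have h1 := (c a).2
    have h2 : k * ((t a).val + 1) ≤ k * (n / k) := Nat.mul_le_mul_left _ (t a).2
    have h3 := Nat.mul_div_le n k
    rw [Nat.mul_add] at h2
    omega
  have hmod : ∀ (t : α ↪ Fin (n / k)) (a : α), ((c a).val + k * (t a).val) % k = (c a).val :=
    fun t a => by rw [Nat.add_mul_mod_self_left, Nat.mod_eq_of_lt (c a).2]
  have hdiv : ∀ (t : α ↪ Fin (n / k)) (a : α), ((c a).val + k * (t a).val) / k = (t a).val :=
    fun t a => by
      rw [Nat.add_mul_div_left _ _ ((Nat.zero_le _).trans_lt (c a).2),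
        Nat.div_eq_of_lt (c a).2, Nat.zero_add]
  have hcard : Nat.card (α ↪ Fin (n / k)) = (n / k).descFactorial (Fintype.card α) := by
    rw [Nat.card_eq_fintype_card, Fintype.card_embedding_eq, Fintype.card_fin]
  rw [← hcard]
  refine Nat.card_le_card_of_injective
    (fun t => ⟨⟨fun a => ⟨(c a).val + k * (t a).val, hlt t a⟩, fun {a b} hab => ?_⟩,
      fun a b hab => t.injective (Fin.ext ?_)⟩) ?_
  · change ((c a).val + k * (t a).val) % k ≠ ((c b).val + k * (t b).val) % k
    rw [hmod, hmod]
    exact fun h => c.valid hab (Fin.ext h)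
  · have : (c a).val + k * (t a).val = (c b).val + k * (t b).val := congrArg Fin.val hab
    rw [← hdiv t a, this, hdiv]
  · intro t u htu
    ext a
    have : (c a).val + k * (t a).val = (c a).val + k * (u a).val :=
      congrArg Fin.val (DFunLike.congr_fun htu a)
    rw [← hdiv t a, this, hdiv]

theorem colorable_pred_of_card_le {α : Type*} [Fintype α] {H : SimpleGraph α} {r : ℕ}
    (hcard : Fintype.card α ≤ r) (hH : ¬ Nonempty (H ≃g (⊤ : SimpleGraph (Fin r)))) :
    H.Colorable (r - 1) := by
  classical
  by_cases hlt : Fintype.card α < r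
  · exact H.colorable_of_fintype.mono (by omega)
  have hr : Fintype.card α = r := by omega
  obtain ⟨u, w, huw, hadj⟩ : ∃ u w, u ≠ w ∧ ¬ H.Adj u w := by
    by_contra! hall
    refine hH ⟨⟨Fintype.equivFinOfCardEq hr, fun {a b} => ?_⟩⟩
    rw [top_adj, (Equiv.injective _).ne_iff]
    exact ⟨hall a b, fun h => h.ne⟩
  let c : H.Coloring {x : α // x ≠ w} :=
    Coloring.mk (fun x => if h : x = w then ⟨u, huw⟩ else ⟨x, h⟩) (by
      intro a b hab heq
      by_cases ha : a = w <;> by_cases hb : b = w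
      · exact hab.ne (ha.trans hb.symm)
      · simp only [ha, hb, dite_true, dite_false, Subtype.mk.injEq] at heq
        subst ha heq
        exact hadj hab.symm
      · simp only [ha, hb, dite_true, dite_false, Subtype.mk.injEq] at heq
        subst hb heq
        exact hadj hab
      · simp only [ha, hb, dite_false, Subtype.mk.injEq] at heq
        exact hab.ne heq)
  have := c.colorable
  rwa [Fintype.card_subtype_compl, Fintype.card_subtype_eq, hr] at this

theorem mul_le_descFactorial_div {k D v n : ℕ} (hk : 0 < k) (hv : 2 ≤ v)
    (hn : k * (k * D * (1 + v) + v) ≤ n) : n * D ≤ (n / k).descFactorial v := by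
  have hq : k * D * (1 + v) + v ≤ n / k := (Nat.le_div_iff_mul_le hk).2 (by rwa [Nat.mul_comm])
  have hnq : n ≤ k * (n / k + 1) := (Nat.lt_mul_div_succ n hk).le
  refine le_trans ?_ (Nat.pow_sub_le_descFactorial (n / k) v)
  obtain ⟨p, hp⟩ : ∃ p, n / k + 1 = p + v := ⟨n / k + 1 - v, by omega⟩
  have hp1 : k * D * (1 + v) + 1 ≤ p := by omega
  rw [hp] at hnq ⊢
  rw [Nat.add_sub_cancel]
  calc n * D ≤ k * (p + v) * D := Nat.mul_le_mul_right _ hnq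
    _ ≤ p ^ 2 := by
      have h1 : k * D * (1 + v) * p ≤ p * p := Nat.mul_le_mul_right _ (by omega)
      have h2 : k * D * (v * 1) ≤ k * D * (v * p) :=
        Nat.mul_le_mul_left _ (Nat.mul_le_mul_left _ (by omega))
      nlinarith
    _ ≤ p ^ v := Nat.pow_le_pow_right (by omega) hv

theorem eventually_mul_le_card_copy_turanGraph {α : Type*} [Fintype α] {H : SimpleGraph α}
    {r : ℕ} (hr : 2 ≤ r) (hH : ¬ Nonempty (H ≃g (⊤ : SimpleGraph (Fin r)))) (v : α) (i : Fin r) :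
    ∃ N, ∀ n ≥ N, n * Nat.card {f : α ↪ Fin r // f v = i}
      ≤ Nat.card (Copy H (turanGraph n (r - 1))) := by
  classical
  by_cases hcard : r < Fintype.card α
  · have : IsEmpty (α ↪ Fin r) := Function.Embedding.isEmpty_of_card_lt (by simpa using hcard)
    exact ⟨0, fun n _ => by simp⟩
  have hcol := colorable_pred_of_card_le (not_lt.1 hcard) hH
  by_cases h1 : Subsingleton α
  · refine ⟨0, fun n _ => ?_⟩
    have hsub : Subsingleton {f : α ↪ Fin r // f v = i} := by
      refine ⟨fun f g => Subtype.ext (Function.Embedding.ext fun a => ?_)⟩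
      rw [Subsingleton.elim a v, f.2, g.2]
    have : Finite (Copy H (turanGraph n (r - 1))) :=
      Finite.of_injective (fun f => (f : α → Fin n)) DFunLike.coe_injective
    calc n * Nat.card {f : α ↪ Fin r // f v = i} ≤ n * 1 :=
          Nat.mul_le_mul_left _ (Finite.card_le_one_iff_subsingleton.2 hsub)
      _ = Nat.card (Fin n) := by simp
      _ ≤ _ := by
        refine Nat.card_le_card_of_injective
          (fun x => ⟨⟨fun _ => x, fun {a b} hab => absurd (Subsingleton.elim a b) hab.ne⟩,
            Function.injective_of_subsingleton _⟩) ?_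
        intro x y hxy
        exact DFunLike.congr_fun hxy v
  · have h2 : 2 ≤ Fintype.card α := by
      rw [not_subsingleton_iff_nontrivial, ← Fintype.one_lt_card_iff_nontrivial] at h1
      exact h1
    exact ⟨_, fun n hn => (mul_le_descFactorial_div (by omega) h2 hn).trans
      (descFactorial_le_card_copy_turanGraph hcol)⟩

theorem eventually_exN_cliquePlusPendant_eq {α : Type*} [Fintype α] {H : SimpleGraph α} {r : ℕ}
    (hr : 2 ≤ r) (hH : H.Connected) (hne : ¬ Nonempty (H ≃g (⊤ : SimpleGraph (Fin r)))) :
    ∃ N, ∀ n ≥ N, exN n H (cliquePlusPendant r) = exN n H (⊤ : SimpleGraph (Fin r)) := by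
  obtain ⟨v⟩ := hH.nonempty
  let i : Fin r := ⟨0, by omega⟩
  obtain ⟨N, hN⟩ := eventually_mul_le_card_copy_turanGraph hr hne v i
  refine ⟨N, fun n hn => le_antisymm (exN_le fun G hG => ?_) (exN_le fun G hG =>
    copyCount_le_exN (gfree_top_iff_cliqueFree.1 hG).gfree_cliquePlusPendant)⟩
  obtain ⟨G', hG', hle⟩ : ∃ G' : SimpleGraph (Fin n), G'.CliqueFree r ∧
      Nat.card (Copy H G) ≤ Nat.card (Copy H G') := by
    rcases exists_cliqueFree_card_copy_ge_or_le hH hG v i with h | h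
    · exact h
    · refine ⟨turanGraph n (r - 1), ?_, h.trans (by simpa using hN n hn)⟩
      have := turanGraph_cliqueFree (n := n) (r := r - 1) (by omega)
      rwa [Nat.sub_add_cancel (by omega)] at this
  exact (copyCount_le_of_card_copy_le hle).trans
    (copyCount_le_exN (gfree_top_iff_cliqueFree.2 hG'))

theorem SimpleGraph.Subgraph.adj_of_iso_top {ι β : Type*} {G : SimpleGraph β} {G' : G.Subgraph}
    (e : (⊤ : SimpleGraph ι) ≃g G'.coe) {x y : β} (hx : x ∈ G'.verts) (hy : y ∈ G'.verts)
    (hxy : x ≠ y) : G'.Adj x y := by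
  have : G'.coe.Adj ⟨x, hx⟩ ⟨y, hy⟩ := by
    refine e.symm.map_adj_iff.1 ?_
    change e.symm ⟨x, hx⟩ ≠ e.symm ⟨y, hy⟩
    exact fun h => hxy (congrArg Subtype.val (e.symm.injective h))
  exact this

theorem copyCount_top_mul_le {β : Type*} [Finite β] {r : ℕ} {G : SimpleGraph β}
    (hG : GFree (cliquePlusPendant r) G) :
    _root_.copyCount (⊤ : SimpleGraph (Fin r)) G * r ≤ Nat.card β := by
  classical
  have := Fintype.ofFinite β
  unfold _root_.copyCount
  let C := {G' : G.Subgraph // Nonempty ((⊤ : SimpleGraph (Fin r)) ≃g G'.coe)}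
  let e : ∀ G' : C, (⊤ : SimpleGraph (Fin r)) ≃g G'.1.coe := fun G' => G'.2.some
  have hclique : ∀ G' : C, G.IsNClique r G'.1.verts.toFinset := by
    intro G'
    rw [isNClique_iff]
    refine ⟨fun x hx y hy hxy => ?_, ?_⟩
    · exact (Subgraph.adj_of_iso_top (e G') (by simpa using hx) (by simpa using hy) hxy).adj_sub
    · rw [Set.toFinset_card, ← Fintype.card_congr (e G').toEquiv, Fintype.card_fin]
  have hsub : ∀ (G₁ G₂ : C) (x : β), x ∈ G₁.1.verts → x ∈ G₂.1.verts →
      G₁.1.verts ⊆ G₂.1.verts := by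
    intro G₁ G₂ x h₁ h₂ y hy
    by_cases hxy : x = y
    · exact hxy ▸ h₂
    · simpa using IsNClique.mem_of_adj_of_gfree hG (hclique G₂) (by simpa using h₂)
        (Subgraph.adj_of_iso_top (e G₁) h₁ hy hxy).adj_sub
  have hle : ∀ G₁ G₂ : C, G₁.1.verts ⊆ G₂.1.verts → G₁.1 ≤ G₂.1 := fun G₁ G₂ h =>
    ⟨h, fun x y hxy => Subgraph.adj_of_iso_top (e G₂) (h hxy.fst_mem) (h hxy.snd_mem) hxy.ne⟩
  have hinj : Function.Injective (fun p : C × Fin r => (e p.1 p.2 : β)) := by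
    rintro ⟨G₁, i⟩ ⟨G₂, j⟩ h
    change (e G₁ i : β) = e G₂ j at h
    have h₁ : (e G₁ i : β) ∈ G₁.1.verts := (e G₁ i).2
    have h₂ : (e G₁ i : β) ∈ G₂.1.verts := h ▸ (e G₂ j).2
    obtain rfl : G₁ = G₂ := Subtype.ext
      (le_antisymm (hle _ _ (hsub _ _ _ h₁ h₂)) (hle _ _ (hsub _ _ _ h₂ h₁)))
    exact Prod.ext rfl ((e G₁).injective (Subtype.ext h))
  have := Nat.card_le_card_of_injective _ hinj
  rwa [Nat.card_prod, Nat.card_eq_fintype_card (α := Fin r), Fintype.card_fin] at this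

/-- The disjoint union of `n / r` copies of `K_r` and `n % r` isolated vertices. -/
def disjointCliques (n r : ℕ) : SimpleGraph (Fin n) :=
  SimpleGraph.fromRel (fun i j => i.val / r = j.val / r ∧ i.val / r < n / r)

theorem disjointCliques_adj {n r : ℕ} {i j : Fin n} :
    (disjointCliques n r).Adj i j ↔ i ≠ j ∧ i.val / r = j.val / r ∧ i.val / r < n / r := by
  rw [disjointCliques, fromRel_adj]
  constructor
  · rintro ⟨h, ⟨h1, h2⟩ | ⟨h1, h2⟩⟩
    · exact ⟨h, h1, h2⟩
    · exact ⟨h, h1.symm, h1 ▸ h2⟩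
  · rintro ⟨h, h1⟩
    exact ⟨h, Or.inl h1⟩

theorem gfree_disjointCliques {n r : ℕ} (hr : 2 ≤ r) :
    GFree (cliquePlusPendant r) (disjointCliques n r) := by
  rintro ⟨f, hf⟩
  have h0 : ∀ j : Fin (r + 1), (f j).val / r = (f 0).val / r := by
    intro j
    by_cases hj : j = 0
    · rw [hj]
    · refine (disjointCliques_adj.1 (hf 0 j ?_)).2.1.symm
      rw [cliquePlusPendant, fromRel_adj]
      exact ⟨Ne.symm hj, Or.inl (Or.inr rfl)⟩
  have hinj : Function.Injective
      (fun j : Fin (r + 1) => (⟨(f j).val % r, Nat.mod_lt _ (by omega)⟩ : Fin r)) := by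
    intro j k hjk
    have hmod : (f j).val % r = (f k).val % r := congrArg Fin.val hjk
    refine f.injective (Fin.ext ?_)
    rw [← Nat.div_add_mod (f j).val r, ← Nat.div_add_mod (f k).val r, h0 j, h0 k, hmod]
  have := Fintype.card_le_of_injective _ hinj
  simp at this

theorem le_copyCount_disjointCliques {n r : ℕ} (hr : 0 < r) :
    n / r ≤ _root_.copyCount (⊤ : SimpleGraph (Fin r)) (disjointCliques n r) := by
  unfold _root_.copyCount
  have hlt : ∀ (q : Fin (n / r)) (a : Fin r), a.val + r * q.val < n := by
    intro q a
    have h1 := a.2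
    have h2 : r * (q.val + 1) ≤ r * (n / r) := Nat.mul_le_mul_left _ q.2
    have h3 := Nat.mul_div_le n r
    rw [Nat.mul_add] at h2
    omega
  have hdiv : ∀ (q : Fin (n / r)) (a : Fin r), (a.val + r * q.val) / r = q.val := fun q a => by
    rw [Nat.add_mul_div_left _ _ hr, Nat.div_eq_of_lt a.2, Nat.zero_add]
  let c : Fin (n / r) → Copy (⊤ : SimpleGraph (Fin r)) (disjointCliques n r) := fun q =>
    ⟨⟨fun a => ⟨a.val + r * q.val, hlt q a⟩, fun {a b} hab => by
      rw [disjointCliques_adj]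
      refine ⟨fun h => hab.ne (Fin.ext ?_), ?_, ?_⟩
      · simpa using h
      · change (a.val + r * q.val) / r = (b.val + r * q.val) / r
        rw [hdiv, hdiv]
      · change (a.val + r * q.val) / r < n / r
        rw [hdiv]
        exact q.2⟩, fun a b hab => Fin.ext (by simpa using hab)⟩
  rw [← Nat.card_fin (n / r)]
  refine Nat.card_le_card_of_injective (fun q => ⟨(c q).toSubgraph, ⟨(c q).isoToSubgraph⟩⟩) ?_
  intro q q' h
  have hs : (c q).toSubgraph = (c q').toSubgraph := congrArg Subtype.val h
  have hmem : c q ⟨0, hr⟩ ∈ (c q').toSubgraph.verts := by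
    rw [← hs]
    exact ⟨⟨0, hr⟩, trivial, rfl⟩
  obtain ⟨a, -, ha⟩ := hmem
  have ha' : a.val + r * q'.val = (⟨0, hr⟩ : Fin r).val + r * q.val := congrArg Fin.val ha
  refine Fin.ext ?_
  rw [← hdiv q ⟨0, hr⟩, ← ha', hdiv]

theorem exN_top_cliquePlusPendant {r : ℕ} (hr : 2 ≤ r) (n : ℕ) :
    exN n (⊤ : SimpleGraph (Fin r)) (cliquePlusPendant r) = n / r := by
  refine le_antisymm (exN_le fun G hG => ?_)
    ((le_copyCount_disjointCliques (by omega)).trans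
      (copyCount_le_exN (gfree_disjointCliques hr)))
  rw [Nat.le_div_iff_mul_le (by omega)]
  simpa using copyCount_top_mul_le hG

/-- Let `F` be `K_r` plus a pendant edge. Then for connected `H ≠ K_r`,
`ex(n, H, F) = ex(n, H, K_r)` for large `n`, and `ex(n, K_r, F) = ⌊n/r⌋`. -/
theorem stmt14 (r : ℕ) (hr : 3 ≤ r) :
    (∀ (γ : Type) [Fintype γ] (H : SimpleGraph γ), H.Connected →
        ¬ Nonempty (H ≃g (⊤ : SimpleGraph (Fin r))) →
        ∃ N : ℕ, ∀ n ≥ N,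
          exN n H (cliquePlusPendant r) = exN n H (⊤ : SimpleGraph (Fin r))) ∧
    (∀ n : ℕ, exN n (⊤ : SimpleGraph (Fin r)) (cliquePlusPendant r) = n / r) := by
  exact ⟨fun γ _ H hH hne => eventually_exN_cliquePlusPendant_eq (by omega) hH hne,
    exN_top_cliquePlusPendant (by omega)⟩
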